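/- arXiv:1705.00277 — 3 statements merged into one kernel-verified Lean document; each statement's English description precedes it below -/
import Mathlib

section
/- Let m⁰ = (m⁰_s, m⁰_m, m⁰_l) ∈ ℝ³ satisfy m⁰_m ≥ 0 and m⁰_s + m⁰_l ≥ 0 (i.e. m⁰ ∈ M₀). Then m⁰ ∈ M₊ ∪ M₃ if and only if there exist a triple m = (m_s, m_m, m_l) ∈ M₊ and a real number ℓ with −m_s/2 ≤ ℓ ≤ m_s/2 + m_l such that m⁰ = (m_s + 2ℓ, m_m, m_l − 2ℓ). -/
/-- For `m⁰ ∈ M₀`, one has `m⁰ ∈ M₊ ∪ M₃` iff `m⁰ = m(ℓ)` for some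
`m ∈ M₊` and `ℓ ∈ [-m_s/2, m_s/2 + m_l]`. -/
theorem stmt_0 (ms0 mm0 ml0 : ℝ)
    (hM0 : mm0 ≥ 0 ∧ ms0 + ml0 ≥ 0) :
    ((ms0 ≥ 0 ∧ mm0 ≥ 0 ∧ ml0 ≥ 0) ∨ (mm0 ≥ 0 ∧ ml0 ≤ 0 ∧ ms0 + 2 * ml0 ≥ 0)) ↔
    (∃ ms mm ml ℓ : ℝ, (ms ≥ 0 ∧ mm ≥ 0 ∧ ml ≥ 0) ∧
      -ms / 2 ≤ ℓ ∧ ℓ ≤ ms / 2 + ml ∧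
      ms0 = ms + 2 * ℓ ∧ mm0 = mm ∧ ml0 = ml - 2 * ℓ) := by
  constructor
  · rintro (⟨hs, hm, hl⟩ | ⟨hm, hl, hsl⟩)
    · exact ⟨ms0, mm0, ml0, 0, ⟨hs, hm, hl⟩, by linarith, by linarith, by ring, rfl, by ring⟩
    · exact ⟨ms0 + ml0, mm0, 0, -ml0 / 2, ⟨hM0.2, hm, le_rfl⟩, by linarith, by linarith,
        by ring, rfl, by ring⟩
  · rintro ⟨ms, mm, ml, ℓ, ⟨hs, hm, hl⟩, hlower, hupper, rfl, rfl, rfl⟩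
    rcases le_total 0 (ml - 2 * ℓ) with h | h
    · exact Or.inl ⟨by linarith, hm, h⟩
    · exact Or.inr ⟨hm, h, by linarith⟩
end

section
/- Let m = (m_s, m_m, m_l) ∈ ℝ³ belong to M₀ but not to M₂ ∪ M₃. Then there exists a real number t such that m_s/2 + m_l · (1 + e^{2t})/(1 + e^t)² < 0. (Hence the corresponding inequality cannot be extended from M₂ ∪ M₃ to all of M₀.) -/
/-- If `m ∈ M₀ \ (M₂ ∪ M₃)`, then there is `t ∈ ℝ` with
`m_s/2 + m_l (1 + e^{2t})/(1 + eᵗ)² < 0`. -/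
theorem stmt_5 (ms mm ml : ℝ)
    (hM0 : mm ≥ 0 ∧ ms + ml ≥ 0)
    (hnot : ¬ ((mm ≥ 0 ∧ ml ≥ 0 ∧ ms + ml ≥ 0) ∨ (mm ≥ 0 ∧ ml ≤ 0 ∧ ms + 2 * ml ≥ 0))) :
    ∃ t : ℝ, ms / 2 + ml * ((1 + Real.exp (2 * t)) / (1 + Real.exp t) ^ 2) < 0 := by
  obtain ⟨hmm, hsum⟩ := hM0
  have hml : ml < 0 := by
    by_contra! h
    exact hnot (Or.inl ⟨hmm, h, hsum⟩)
  have hd : 0 < -(ms + 2 * ml) := by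
    by_contra! h
    exact hnot (Or.inr ⟨hmm, hml.le, by linarith⟩)
  have hms : 0 < ms := by linarith
  obtain ⟨x, hx⟩ : ∃ x, x = 2 * ms / -(ms + 2 * ml) := ⟨_, rfl⟩
  have hx0 : 0 < x := hx ▸ by positivity
  have hxd : x * -(ms + 2 * ml) = 2 * ms := by rw [hx, div_mul_cancel₀ _ hd.ne']
  refine ⟨Real.log x, ?_⟩
  have hexp : Real.exp (2 * Real.log x) = x ^ 2 := by
    rw [two_mul, Real.exp_add, Real.exp_log hx0, sq]
  rw [hexp, Real.exp_log hx0]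
  have key : ms / 2 + ml * ((1 + x ^ 2) / (1 + x) ^ 2) =
      (ms + 2 * ml) / (2 * (1 + x) ^ 2) := by
    field_simp
    linear_combination (-x) * hxd
  rw [key]
  exact div_neg_of_neg_of_pos (by linarith) (by positivity)
end

section
/- Fix r ≥ 1, the BC_r positive roots Σ⁺ in ℝ^r, a multiplicity triple m = (m_s, m_m, m_l), ℓ ∈ ℝ, the deformed triple m(ℓ), and u(x) = ∏_{j=1}^r cosh(x_j/2). For α ∈ Σ⁺ let r_α(x) = x − 2(⟨x,α⟩/⟨α,α⟩)α. For a function f : ℝ^r → ℂ differentiable at a regular point x (i.e. ⟨α,x⟩ ≠ 0 for all α ∈ Σ⁺) and ξ ∈ ℝ^r, define T_ξ(m(ℓ))f(x) = ∂_ξ f(x) − ⟨ρ(m(ℓ)), ξ⟩ f(x) + Σ_{α∈Σ⁺} m_α(ℓ) ⟨α, ξ⟩ (f(x) − f(r_α x))/(1 − e^{−2⟨α,x⟩}). Then the τ_{−ℓ}-Cherednik operator T_{ℓ,ξ}(m)f(x) := (ℓ/2) Σ_{j=1}^r ξ_j tanh(x_j/2) f(x) + T_ξ(m(ℓ))f(x)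 satisfies T_{ℓ,ξ}(m)f(x) = u(x)^{−ℓ} · T_ξ(m(ℓ))(u^ℓ f)(x), where (u^ℓ f)(y) = u(y)^ℓ f(y). -/
open Finset

/-- The standard basis vector `e_j` of `ℝ^r`. -/
noncomputable def eVec (r : ℕ) (j : Fin r) : Fin r → ℝ := Pi.single j 1

/-- The standard inner product on `ℝ^r`. -/
noncomputable def inn {r : ℕ} (a b : Fin r → ℝ) : ℝ := ∑ k, a k * b k

/-- The set of positive roots of type `BC_r` in `ℝ^r`. -/
def SigmaPlus (r : ℕ) : Set (Fin r → ℝ) :=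
  {α | (∃ j : Fin r, α = (1 / 2 : ℝ) • eVec r j) ∨
       (∃ i j : Fin r, i < j ∧
          (α = (1 / 2 : ℝ) • (eVec r j - eVec r i) ∨
           α = (1 / 2 : ℝ) • (eVec r j + eVec r i))) ∨
       (∃ j : Fin r, α = eVec r j)}

/-- `ρ(m) = (1/2) Σ_{α ∈ Σ⁺} m_α α` for the `BC_r` positive roots and the
multiplicity triple `(m_s, m_m, m_l)`. -/
noncomputable def rho (r : ℕ) (ms mm ml : ℝ) : Fin r → ℝ :=
  (1 / 2 : ℝ) •
    ((∑ j : Fin r, ms • ((1 / 2 : ℝ) • eVec r j)) +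
     (∑ j : Fin r, ∑ i ∈ Finset.univ.filter (fun i : Fin r => i < j),
        (mm • ((1 / 2 : ℝ) • (eVec r j - eVec r i)) +
         mm • ((1 / 2 : ℝ) • (eVec r j + eVec r i)))) +
     (∑ j : Fin r, ml • eVec r j))

/-- The reflection `r_α x = x − 2(⟨x,α⟩/⟨α,α⟩) α`. -/
noncomputable def reflRoot {r : ℕ} (α x : Fin r → ℝ) : Fin r → ℝ :=
  x - (2 * (inn x α / inn α α)) • α

/-- The summand `c ⟨α,ξ⟩ (f(x) − f(r_α x)) / (1 − e^{−2⟨α,x⟩})` of the Cherednik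
operator, for a root `α` with multiplicity value `c`. -/
noncomputable def cherTerm {r : ℕ} (c : ℝ) (α ξ x : Fin r → ℝ)
    (f : (Fin r → ℝ) → ℂ) : ℂ :=
  ((c * inn α ξ / (1 - Real.exp (-(2 * inn α x))) : ℝ) : ℂ) *
    (f x - f (reflRoot α x))

/-- The Cherednik operator `T_ξ(m) f(x) = ∂_ξ f(x) − ⟨ρ(m),ξ⟩ f(x)
+ Σ_{α ∈ Σ⁺} m_α ⟨α,ξ⟩ (f(x) − f(r_α x))/(1 − e^{−2⟨α,x⟩})`, for the `BC_r`
positive roots and the multiplicity triple `(m_s, m_m, m_l)`. -/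
noncomputable def Tcher (r : ℕ) (ms mm ml : ℝ) (ξ : Fin r → ℝ)
    (f : (Fin r → ℝ) → ℂ) (x : Fin r → ℝ) : ℂ :=
  fderiv ℝ f x ξ - ((inn (rho r ms mm ml) ξ : ℝ) : ℂ) * f x +
    (∑ j : Fin r, cherTerm ms ((1 / 2 : ℝ) • eVec r j) ξ x f) +
    (∑ j : Fin r, ∑ i ∈ Finset.univ.filter (fun i : Fin r => i < j),
       (cherTerm mm ((1 / 2 : ℝ) • (eVec r j - eVec r i)) ξ x f +
        cherTerm mm ((1 / 2 : ℝ) • (eVec r j + eVec r i)) ξ x f)) +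
    (∑ j : Fin r, cherTerm ml (eVec r j) ξ x f)

/-- `u(x) = ∏_{j=1}^r cosh(x_j/2)` on `ℝ^r`. -/
noncomputable def uFun (r : ℕ) (x : Fin r → ℝ) : ℝ := ∏ j, Real.cosh (x j / 2)

theorem uFun_eq_of_signed_perm {r : ℕ} {x y : Fin r → ℝ} (σ : Equiv.Perm (Fin r))
    (h : ∀ k, y k = x (σ k) ∨ y k = -x (σ k)) : uFun r y = uFun r x := by
  unfold uFun
  rw [← Equiv.prod_comp σ fun j => Real.cosh (x j / 2)]
  refine Finset.prod_congr rfl fun k _ => ?_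
  rcases h k with h | h <;> simp [h, neg_div]

theorem inn_eVec_right {r : ℕ} (x : Fin r → ℝ) (j : Fin r) : inn x (eVec r j) = x j := by
  simp [inn, eVec, Pi.single_apply]

theorem inn_smul_right {r : ℕ} (c : ℝ) (x y : Fin r → ℝ) : inn x (c • y) = c * inn x y := by
  simp only [inn, Pi.smul_apply, smul_eq_mul, Finset.mul_sum]
  exact Finset.sum_congr rfl fun k _ => by ring

theorem inn_add_right {r : ℕ} (x y z : Fin r → ℝ) : inn x (y + z) = inn x y + inn x z := by
  simp [inn, mul_add, Finset.sum_add_distrib]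

theorem inn_sub_right {r : ℕ} (x y z : Fin r → ℝ) : inn x (y - z) = inn x y - inn x z := by
  simp [inn, mul_sub, Finset.sum_sub_distrib]

/-- The function `u` is invariant under the reflections in the roots of type `BC_r`. -/
theorem uFun_reflRoot {r : ℕ} {α : Fin r → ℝ} (hα : α ∈ SigmaPlus r) (x : Fin r → ℝ) :
    uFun r (reflRoot α x) = uFun r x := by
  rcases hα with ⟨j, rfl⟩ | ⟨i, j, hij, rfl | rfl⟩ | ⟨j, rfl⟩
  · refine uFun_eq_of_signed_perm (Equiv.refl _) fun k => ?_
    simp only [reflRoot, inn_smul_right, inn_eVec_right]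
    by_cases hk : k = j
    · subst hk; right; simp [eVec]; ring
    · left; simp [eVec, hk]
  · refine uFun_eq_of_signed_perm (Equiv.swap i j) fun k => Or.inl ?_
    simp only [reflRoot, inn_smul_right, inn_sub_right, inn_eVec_right]
    by_cases hk : k = j
    · subst hk; simp [eVec, hij.ne, hij.ne']; ring
    · by_cases hk' : k = i
      · subst hk'; simp [eVec, hij.ne, hij.ne']; ring
      · simp [eVec, hk, hk', Equiv.swap_apply_of_ne_of_ne]
  · refine uFun_eq_of_signed_perm (Equiv.swap i j) fun k => ?_
    simp only [reflRoot, inn_smul_right, inn_add_right, inn_eVec_right]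
    by_cases hk : k = j
    · subst hk; right; simp [eVec, hij.ne, hij.ne']; ring
    · by_cases hk' : k = i
      · subst hk'; right; simp [eVec, hij.ne, hij.ne']; ring
      · left; simp [eVec, hk, hk', Equiv.swap_apply_of_ne_of_ne]
  · refine uFun_eq_of_signed_perm (Equiv.refl _) fun k => ?_
    simp only [reflRoot, inn_eVec_right]
    by_cases hk : k = j
    · subst hk; right; simp [eVec]; ring
    · left; simp [eVec, hk]

theorem uFun_pos {r : ℕ} (x : Fin r → ℝ) : 0 < uFun r x :=
  Finset.prod_pos fun _ _ => Real.cosh_pos _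

/-- Multiplication by a power of `u` commutes with each difference term. -/
theorem cherTerm_uFun_rpow_mul {r : ℕ} {α : Fin r → ℝ} (hα : α ∈ SigmaPlus r) (c ℓ : ℝ)
    (ξ x : Fin r → ℝ) (f : (Fin r → ℝ) → ℂ) :
    cherTerm c α ξ x (fun y => ((Real.rpow (uFun r y) ℓ : ℝ) : ℂ) * f y)
      = ((Real.rpow (uFun r x) ℓ : ℝ) : ℂ) * cherTerm c α ξ x f := by
  simp only [cherTerm, uFun_reflRoot hα]
  ring

theorem hasFDerivAt_uFun {r : ℕ} (x : Fin r → ℝ) :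
    HasFDerivAt (uFun r)
      (uFun r x • ∑ j, (Real.tanh (x j / 2) / 2) •
        (ContinuousLinearMap.proj j : (Fin r → ℝ) →L[ℝ] ℝ)) x := by
  have h := HasFDerivAt.finsetProd (u := Finset.univ)
    (g := fun (j : Fin r) (y : Fin r → ℝ) => Real.cosh (y j / 2))
    (g' := fun j => (Real.sinh (x j / 2) / 2) •
      (ContinuousLinearMap.proj j : (Fin r → ℝ) →L[ℝ] ℝ)) (x := x)
    fun j _ => by
      have hc : HasDerivAt (fun t : ℝ => Real.cosh (t / 2)) (Real.sinh (x j / 2) / 2) (x j) := by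
        have := ((hasDerivAt_id' (x j)).div_const 2).cosh
        rwa [← div_eq_mul_one_div] at this
      exact HasDerivAt.comp_hasFDerivAt (f := fun y : Fin r → ℝ => y j) x hc
        (hasFDerivAt_apply j x)
  refine h.congr_fderiv ?_
  rw [Finset.smul_sum]
  refine Finset.sum_congr rfl fun j hj => ?_
  rw [smul_smul, smul_smul, uFun, ← Finset.mul_prod_erase _ _ hj, Real.tanh_eq_sinh_div_cosh]
  congr 1
  have := (Real.cosh_pos (x j / 2)).ne'
  field_simp

theorem fderiv_uFun_rpow_mul {r : ℕ} (ℓ : ℝ) (ξ x : Fin r → ℝ) {f : (Fin r → ℝ) → ℂ}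
    (hf : DifferentiableAt ℝ f x) :
    fderiv ℝ (fun y => ((Real.rpow (uFun r y) ℓ : ℝ) : ℂ) * f y) x ξ
      = ((Real.rpow (uFun r x) ℓ : ℝ) : ℂ) *
        (((ℓ / 2 * ∑ j, ξ j * Real.tanh (x j / 2) : ℝ) : ℂ) * f x + fderiv ℝ f x ξ) := by
  have hu := uFun_pos x
  have hp := (hasFDerivAt_uFun x).rpow_const (p := ℓ) (Or.inl hu.ne')
  have h := (Complex.ofRealCLM.hasFDerivAt.comp x hp).mul hf.hasFDerivAt
  have hpow : uFun r x ^ (ℓ - 1) * uFun r x = uFun r x ^ ℓ := by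
    rw [← Real.rpow_add_one hu.ne', sub_add_cancel]
  have hsum : ∑ j, Real.tanh (x j / 2) / 2 * ξ j
      = (∑ j, ξ j * Real.tanh (x j / 2)) / 2 := by
    rw [Finset.sum_div]
    exact Finset.sum_congr rfl fun j _ => by ring
  have e := congrArg (fun L => L ξ) h.fderiv
  refine Eq.trans e ?_
  simp [hsum]
  rw [← hpow]
  push_cast
  ring

/-- the `τ_{−ℓ}`-Cherednik operator
`T_{ℓ,ξ}(m) f(x) = (ℓ/2) Σ_j ξ_j tanh(x_j/2) f(x) + T_ξ(m(ℓ)) f(x)`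
satisfies `T_{ℓ,ξ}(m) f(x) = u(x)^{−ℓ} T_ξ(m(ℓ)) (u^ℓ f)(x)` at every regular
point `x` where `f` is differentiable; here
`m(ℓ) = (m_s + 2ℓ, m_m, m_l − 2ℓ)`. -/
theorem stmt_15 (r : ℕ) (hr : 1 ≤ r) (ms mm ml ℓ : ℝ) (ξ x : Fin r → ℝ)
    (f : (Fin r → ℝ) → ℂ)
    (hreg : ∀ α ∈ SigmaPlus r, inn α x ≠ 0)
    (hf : DifferentiableAt ℝ f x) :
    ((ℓ / 2 * ∑ j, ξ j * Real.tanh (x j / 2) : ℝ) : ℂ) * f x +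
        Tcher r (ms + 2 * ℓ) mm (ml - 2 * ℓ) ξ f x
      = ((Real.rpow (uFun r x) (-ℓ) : ℝ) : ℂ) *
          Tcher r (ms + 2 * ℓ) mm (ml - 2 * ℓ) ξ
            (fun y => ((Real.rpow (uFun r y) ℓ : ℝ) : ℂ) * f y) x := by
  have hs : ∀ j, (1 / 2 : ℝ) • eVec r j ∈ SigmaPlus r := fun j => Or.inl ⟨j, rfl⟩
  have hl : ∀ j, eVec r j ∈ SigmaPlus r := fun j => Or.inr (Or.inr ⟨j, rfl⟩)
  have hm : ∀ (c : ℝ) (g : (Fin r → ℝ) → ℂ), (∀ α ∈ SigmaPlus r, cherTerm c α ξ x g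
      = ((Real.rpow (uFun r x) ℓ : ℝ) : ℂ) * cherTerm c α ξ x f) →
      ∑ j : Fin r, ∑ i ∈ Finset.univ.filter (fun i : Fin r => i < j),
        (cherTerm c ((1 / 2 : ℝ) • (eVec r j - eVec r i)) ξ x g +
          cherTerm c ((1 / 2 : ℝ) • (eVec r j + eVec r i)) ξ x g)
      = ((Real.rpow (uFun r x) ℓ : ℝ) : ℂ) *
        ∑ j : Fin r, ∑ i ∈ Finset.univ.filter (fun i : Fin r => i < j),
        (cherTerm c ((1 / 2 : ℝ) • (eVec r j - eVec r i)) ξ x f +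
          cherTerm c ((1 / 2 : ℝ) • (eVec r j + eVec r i)) ξ x f) := by
    intro c g hg
    rw [Finset.mul_sum]
    refine Finset.sum_congr rfl fun j _ => ?_
    rw [Finset.mul_sum]
    refine Finset.sum_congr rfl fun i hi => ?_
    have hij := (Finset.mem_filter.mp hi).2
    rw [hg _ (Or.inr (Or.inl ⟨i, j, hij, Or.inl rfl⟩)),
      hg _ (Or.inr (Or.inl ⟨i, j, hij, Or.inr rfl⟩)), mul_add]
  have hinv : ((Real.rpow (uFun r x) (-ℓ) : ℝ) : ℂ) * ((Real.rpow (uFun r x) ℓ : ℝ) : ℂ) = 1 := by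
    rw [← Complex.ofReal_mul, Real.rpow_eq_pow, Real.rpow_eq_pow, ← Real.rpow_add (uFun_pos x)]
    simp
  unfold Tcher
  rw [fderiv_uFun_rpow_mul ℓ ξ x hf, hm _ _ fun α hα => cherTerm_uFun_rpow_mul hα mm ℓ ξ x f,
    Finset.sum_congr rfl fun j _ => cherTerm_uFun_rpow_mul (hs j) (ms + 2 * ℓ) ℓ ξ x f,
    Finset.sum_congr rfl fun j _ => cherTerm_uFun_rpow_mul (hl j) (ml - 2 * ℓ) ℓ ξ x f,
    ← Finset.mul_sum, ← Finset.mul_sum]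
  beta_reduce
  generalize ((Real.rpow (uFun r x) (-ℓ) : ℝ) : ℂ) = v at hinv ⊢
  generalize ((Real.rpow (uFun r x) ℓ : ℝ) : ℂ) = w at hinv ⊢
  refine (one_mul _).symm.trans ((congrArg (· * _) hinv.symm).trans ?_)
  ring
end
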